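/- arXiv:2512.07736 — 3 statements merged into one kernel-verified Lean document; each statement's English description precedes it below -/
import Mathlib

section
/- Let (X, 𝓜, μ) be a measure space equipped with a doubling and regular ball-basis 𝔅 and fix 1 ≤ r < ∞. Then there exists an admissible constant α ∈ (1/2, 1) such that BMO_α(X) = BMO(X); moreover, there exist admissible constants c₁, c₂ > 0 such that every measurable a.e.-finite function f with ‖f‖_{BMO_α} < ∞ satisfies c₁ ‖f‖_{BMO_α} ≤ ‖f‖_BMO ≤ c₂ ‖f‖_{BMO_α}. -/
open MeasureTheory Set
open scoped ENNReal NNReal symmDiff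

variable {X : Type*}

structure IsBallBasis [MeasurableSpace X] (μ : Measure X) (𝔅 : Set (Set X))
    (hull : Set X → Set X) (K : ℝ) : Prop where
  measurableSet : ∀ B ∈ 𝔅, MeasurableSet B
  measure_pos : ∀ B ∈ 𝔅, 0 < μ B
  measure_lt_top : ∀ B ∈ 𝔅, μ B < ∞
  exists_ball : ∀ x y : X, ∃ B ∈ 𝔅, x ∈ B ∧ y ∈ B
  approx : ∀ E : Set X, MeasurableSet E → ∀ ε : ℝ≥0∞, 0 < ε →
    ∃ 𝒞 ⊆ 𝔅, 𝒞.Countable ∧ μ (E ∆ ⋃₀ 𝒞) < ε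
  hull_mem : ∀ B ∈ 𝔅, hull B ∈ 𝔅
  hull_measure : ∀ B ∈ 𝔅, μ (hull B) ≤ ENNReal.ofReal K * μ B
  subset_hull : ∀ B ∈ 𝔅, ∀ A ∈ 𝔅, μ A ≤ 2 * μ B → (A ∩ B).Nonempty → A ⊆ hull B

def IsDoublingBasis [MeasurableSpace X] (μ : Measure X) (𝔅 : Set (Set X))
    (hull : Set X → Set X) (η : ℝ) : Prop :=
  ∀ B ∈ 𝔅, hull B ≠ Set.univ →
    ∃ B' ∈ 𝔅, B ⊆ B' ∧ 2 * μ B ≤ μ B' ∧ μ B' ≤ ENNReal.ofReal η * μ B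

def IsRegularBasis [MeasurableSpace X] (μ : Measure X) (𝔅 : Set (Set X))
    (hull : Set X → Set X) (θ : ℝ) : Prop :=
  ∀ A ∈ 𝔅, ∀ B ∈ 𝔅, μ B ≤ μ A → (B ∩ A).Nonempty →
    ENNReal.ofReal θ * μ (hull B) ≤ μ (hull B ∩ A)

/-- The mean `f_B` of `f` over a set `B`. -/
noncomputable def mean [MeasurableSpace X] (μ : Measure X) (f : X → ℝ) (B : Set X) : ℝ :=
  (∫ x in B, f x ∂μ) / (μ B).toReal

/-- `⟨f⟩_B`, the `L^r` average of `f` over `B`, valued in `ℝ≥0∞`. -/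
noncomputable def avgNorm [MeasurableSpace X] (μ : Measure X) (r : ℝ) (f : X → ℝ) (B : Set X) :
    ℝ≥0∞ :=
  ((∫⁻ x in B, ENNReal.ofReal |f x| ^ r ∂μ) / μ B) ^ (1 / r)

/-- `⟨f⟩_{#,B}`. -/
noncomputable def sharpNorm [MeasurableSpace X] (μ : Measure X) (r : ℝ) (f : X → ℝ) (B : Set X) :
    ℝ≥0∞ :=
  avgNorm μ r (fun x => f x - mean μ f B) B

/-- `⟨f⟩*_{#,B}`. -/
noncomputable def sharpStar [MeasurableSpace X] (μ : Measure X) (𝔅 : Set (Set X)) (r : ℝ)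
    (f : X → ℝ) (B : Set X) : ℝ≥0∞ :=
  ⨆ (A : Set X) (_ : A ∈ 𝔅 ∧ B ⊆ A), sharpNorm μ r f A

/-- `⟨f⟩*_B`. -/
noncomputable def avgStar [MeasurableSpace X] (μ : Measure X) (𝔅 : Set (Set X)) (r : ℝ)
    (f : X → ℝ) (B : Set X) : ℝ≥0∞ :=
  ⨆ (A : Set X) (_ : A ∈ 𝔅 ∧ B ⊆ A), avgNorm μ r f A

/-- essential oscillation `OSC_E(f)` of a measurable function. -/
noncomputable def oscE [MeasurableSpace X] (μ : Measure X) (f : X → ℝ) (E : Set X) : ℝ≥0∞ :=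
  essSup (fun p : X × X => ENNReal.ofReal |f p.1 - f p.2|) ((μ.restrict E).prod (μ.restrict E))

/-- pointwise oscillation `sup_{x,x'∈E} |g x − g x'|` of an arbitrary function. -/
noncomputable def oscSup (g : X → ℝ) (E : Set X) : ℝ≥0∞ :=
  ⨆ (x : X) (_ : x ∈ E) (y : X) (_ : y ∈ E), ENNReal.ofReal |g x - g y|

/-- `OSC_{B,β}(g)` for a possibly non-measurable `g`. -/
noncomputable def oscBeta [MeasurableSpace X] (μ : Measure X) (g : X → ℝ) (B : Set X) (β : ℝ) :
    ℝ≥0∞ :=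
  ⨅ (E : Set X) (_ : MeasurableSet E ∧ E ⊆ B ∧ ENNReal.ofReal β * μ B < μ E), oscSup g E

/-- `OSC_{B,α}(f)` for measurable `f` (essential-oscillation version). -/
noncomputable def oscAlpha [MeasurableSpace X] (μ : Measure X) (f : X → ℝ) (B : Set X) (α : ℝ) :
    ℝ≥0∞ :=
  ⨅ (E : Set X) (_ : MeasurableSet E ∧ E ⊆ B ∧ ENNReal.ofReal α * μ B < μ E), oscE μ f E

/-- the `L^r` norm. -/
noncomputable def lrNorm [MeasurableSpace X] (μ : Measure X) (r : ℝ) (f : X → ℝ) : ℝ≥0∞ :=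
  (∫⁻ x, ENNReal.ofReal |f x| ^ r ∂μ) ^ (1 / r)

/-- membership in `L^r(X)`. -/
def MemLr [MeasurableSpace X] (μ : Measure X) (r : ℝ) (f : X → ℝ) : Prop :=
  AEMeasurable f μ ∧ lrNorm μ r f < ∞

/-- the weak `L^{r,∞}` (outer-measure) quasinorm of a possibly non-measurable function. -/
noncomputable def wnorm [MeasurableSpace X] (μ : Measure X) (r : ℝ) (g : X → ℝ) : ℝ≥0∞ :=
  ⨆ (t : ℝ) (_ : 0 < t), ENNReal.ofReal t * μ {x | t < |g x|} ^ (1 / r)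

/-- `‖T‖_{L^r → L^{r,∞}}`. -/
noncomputable def opWeakNorm [MeasurableSpace X] (μ : Measure X) (r : ℝ)
    (T : (X → ℝ) → X → ℝ) : ℝ≥0∞ :=
  ⨆ (f : X → ℝ) (_ : MemLr μ r f ∧ lrNorm μ r f ≠ 0), wnorm μ r (T f) / lrNorm μ r f

/-- `T` is a `BO_ω` operator with constant `L`. -/
def IsBO [MeasurableSpace X] (μ : Measure X) (𝔅 : Set (Set X)) (hull : Set X → Set X)
    (r : ℝ) (ω : ℝ → ℝ) (T : (X → ℝ) → X → ℝ) (L : ℝ≥0∞) : Prop :=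
  (∀ f g : X → ℝ, MemLr μ r f → MemLr μ r g →
      ∀ᵐ x ∂μ, |T (f + g) x| ≤ |T f x| + |T g x|) ∧
  ∀ f : X → ℝ, MemLr μ r f → ∀ B ∈ 𝔅,
    oscE μ (T (Set.indicator (hull B)ᶜ f)) B ≤
      L * ⨆ (A : Set X) (_ : A ∈ 𝔅 ∧ B ⊆ A),
        ENNReal.ofReal (ω ((μ A).toReal / (μ B).toReal)) * avgNorm μ r f A

/-- `T` is linear on `L^r` (a.e.). -/
def IsLinearOnLr [MeasurableSpace X] (μ : Measure X) (r : ℝ) (T : (X → ℝ) → X → ℝ) : Prop :=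
  (∀ f g : X → ℝ, MemLr μ r f → MemLr μ r g →
      ∀ᵐ x ∂μ, T (f + g) x = T f x + T g x) ∧
  (∀ (c : ℝ) (f : X → ℝ), MemLr μ r f → ∀ᵐ x ∂μ, T (c • f) x = c * T f x)

/-- a family of operators is uniformly vanishing. -/
def UniformlyVanishing {ι : Type*} [MeasurableSpace X] (μ : Measure X) (𝔅 : Set (Set X))
    (T : ι → (X → ℝ) → X → ℝ) : Prop :=
  ∀ B ∈ 𝔅, ∀ ε : ℝ, 0 < ε → ∃ B' ∈ 𝔅, B ⊆ B' ∧
    ∀ α, ∀ B'' ∈ 𝔅, B' ⊆ B'' →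
      oscE μ (T α (Set.indicator B'' fun _ => (1 : ℝ))) B ≤ ENNReal.ofReal ε
/-- the `BMO` norm of a measurable function. -/
noncomputable def bmoNorm [MeasurableSpace X] (μ : Measure X) (𝔅 : Set (Set X)) (r : ℝ)
    (f : X → ℝ) : ℝ≥0∞ :=
  ⨆ (B : Set X) (_ : B ∈ 𝔅), sharpNorm μ r f B

/-- the `BMO` norm, in the outer-measure sense, of a possibly non-measurable function. -/
noncomputable def obmoNorm [MeasurableSpace X] (μ : Measure X) (𝔅 : Set (Set X)) (r : ℝ)
    (g : X → ℝ) : ℝ≥0∞ :=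
  ⨆ (B : Set X) (_ : B ∈ 𝔅), ⨅ (a : ℝ),
    ((∫⁻ t in Set.Ioi (0 : ℝ), ENNReal.ofReal (r * t ^ (r - 1)) * μ {x ∈ B | t < |g x - a|}) /
        μ B) ^ (1 / r)
/-- the `BMO_α` norm of a measurable function. -/
noncomputable def bmoAlphaNorm [MeasurableSpace X] (μ : Measure X) (𝔅 : Set (Set X)) (α : ℝ)
    (f : X → ℝ) : ℝ≥0∞ :=
  ⨆ (B : Set X) (_ : B ∈ 𝔅), oscAlpha μ f B α

lemma vitali_sel [MeasurableSpace X] {μ : Measure X} {𝔅 : Set (Set X)}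
    {hull : Set X → Set X} {K : ℝ} (hb : IsBallBasis μ 𝔅 hull K) (𝒟 : Set (Set X))
    (h𝒟 : 𝒟 ⊆ 𝔅) (S : Set X) (hS : μ S ≠ ∞) (c : ℝ≥0∞) (hc : c ≠ ∞)
    (h : ∀ D ∈ 𝒟, μ D ≤ c * μ (D ∩ S)) :
    ∃ u ⊆ 𝒟, u.Countable ∧ (∀ D ∈ 𝒟, ∃ D' ∈ u, D ⊆ hull D') ∧
      ∑' D : u, μ (D : Set X) ≤ c * μ S := by
  have hne : ∀ D ∈ 𝔅, D.Nonempty := fun D hD =>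
    nonempty_of_measure_ne_zero (hb.measure_pos D hD).ne'
  obtain ⟨u, hu, hdis, hcov⟩ := Vitali.exists_disjoint_subfamily_covering_enlargement
    (fun D : Set X => D) 𝒟 (fun D => (μ D).toReal) 2 (by norm_num)
    (fun _ _ => ENNReal.toReal_nonneg) (c * μ S).toReal
    (fun D hD => ENNReal.toReal_mono (ENNReal.mul_ne_top hc hS)
      ((h D hD).trans (by gcongr; exact inter_subset_right)))
    (fun D hD => hne D (h𝒟 hD))
  have : IsFiniteMeasure (μ.restrict S) := ⟨by simpa using hS.lt_top⟩
  have hpos : ∀ D ∈ u, 0 < (μ.restrict S) D := by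
    intro D hD
    rw [Measure.restrict_apply (hb.measurableSet D (h𝒟 (hu hD)))]
    by_contra h0
    have h1 : μ (D ∩ S) = 0 := by simpa using h0
    have h2 := h D (hu hD)
    rw [h1, mul_zero] at h2
    exact absurd (hb.measure_pos D (h𝒟 (hu hD))) (by simpa using h2)
  have hmeas : ∀ D : u, MeasurableSet (D : Set X) := fun D =>
    hb.measurableSet D (h𝒟 (hu D.2))
  have hpd : Pairwise (Function.onFun Disjoint (fun D : u => (D : Set X))) := by
    intro a b hab
    exact hdis a.2 b.2 (fun h => hab (Subtype.ext h))
  have hcnt : u.Countable := by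
    have h1 := Measure.countable_meas_pos_of_disjoint_iUnion (μ := μ.restrict S)
      (As := fun D : u => (D : Set X)) hmeas hpd
    have h2 : {i : u | 0 < (μ.restrict S) (i : Set X)} = Set.univ := by
      ext i; simpa using hpos i i.2
    rw [h2, Set.countable_univ_iff] at h1
    exact h1
  refine ⟨u, hu, hcnt, ?_, ?_⟩
  · intro D hD
    obtain ⟨b, hbu, hne', hle⟩ := hcov D hD
    have hb1 := h𝒟 (hu hbu)
    refine ⟨b, hbu, hb.subset_hull b hb1 D (h𝒟 hD) ?_ hne'⟩
    rw [← ENNReal.toReal_le_toReal (hb.measure_lt_top D (h𝒟 hD)).ne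
      (ENNReal.mul_ne_top (by norm_num) (hb.measure_lt_top b hb1).ne)]
    simpa using hle
  · have : Countable u := hcnt
    calc ∑' D : u, μ (D : Set X) ≤ ∑' D : u, c * (μ.restrict S) (D : Set X) :=
          ENNReal.tsum_le_tsum fun D => by
            rw [Measure.restrict_apply (hmeas D)]; exact h D (hu D.2)
      _ = c * ∑' D : u, (μ.restrict S) (D : Set X) := ENNReal.tsum_mul_left
      _ = c * (μ.restrict S) (⋃ D : u, (D : Set X)) := by
          rw [measure_iUnion hpd hmeas]
      _ ≤ c * (μ.restrict S) Set.univ := by gcongr; exact subset_univ _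
      _ = c * μ S := by simp

lemma density_null [MeasurableSpace X] {μ : Measure X} {𝔅 : Set (Set X)}
    {hull : Set X → Set X} {K : ℝ} (hb : IsBallBasis μ 𝔅 hull K) (F : Set X)
    (hF : MeasurableSet F) (σ : ℝ≥0∞) (hσ : σ ≤ 1 / 2) :
    μ (F \ ⋃₀ {D ∈ 𝔅 | σ * μ D < μ (D ∩ F)}) = 0 := by
  set k := ENNReal.ofReal K with hk
  have key : ∀ ε : ℝ≥0∞, 0 < ε → ε ≠ ∞ →
      μ (F \ ⋃₀ {D ∈ 𝔅 | σ * μ D < μ (D ∩ F)}) ≤ (1 + k * 2) * ε := by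
    intro ε hε hεt
    obtain ⟨𝒞, h𝒞, hcnt, hμ⟩ := hb.approx F hF ε hε
    set 𝒟 : Set (Set X) := {C ∈ 𝒞 | μ (C ∩ F) ≤ σ * μ C} with h𝒟
    have hS : μ (⋃₀ 𝒞 \ F) ≤ ε :=
      (measure_mono (fun x hx => Or.inr hx)).trans hμ.le
    have hhalf : ∀ D ∈ 𝒟, μ D ≤ 2 * μ (D ∩ (⋃₀ 𝒞 \ F)) := by
      intro D hD
      have e1 : D ∩ (⋃₀ 𝒞 \ F) = D \ F := by
        ext x; constructor
        · rintro ⟨a, b, c⟩; exact ⟨a, c⟩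
        · rintro ⟨a, c⟩; exact ⟨a, ⟨D, hD.1, a⟩, c⟩
      rw [e1]
      have e2 := measure_inter_add_sdiff (μ := μ) D hF
      have ht := (hb.measure_lt_top D (h𝒞 hD.1)).ne
      have e3 : μ (D ∩ F) ≤ 1 / 2 * μ D := hD.2.trans (by gcongr)
      have t1 : μ (D ∩ F) ≠ ∞ := (measure_mono inter_subset_left |>.trans_lt ht.lt_top).ne
      have t2 : μ (D \ F) ≠ ∞ := (measure_mono sdiff_subset |>.trans_lt ht.lt_top).ne
      rw [← ENNReal.toReal_le_toReal ht (ENNReal.mul_ne_top (by norm_num) t2)]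
      rw [← ENNReal.toReal_le_toReal t1 (ENNReal.mul_ne_top (by norm_num) ht)] at e3
      have e4 := congrArg ENNReal.toReal e2
      rw [ENNReal.toReal_add t1 t2] at e4
      simp at e3 ⊢
      linarith
    obtain ⟨u, hu, hucnt, hcov, hsum⟩ := vitali_sel hb 𝒟 (fun D hD => h𝒞 hD.1)
      (⋃₀ 𝒞 \ F) (hS.trans_lt hεt.lt_top).ne 2 (by norm_num) hhalf
    have hsub : F \ ⋃₀ {D ∈ 𝔅 | σ * μ D < μ (D ∩ F)} ⊆
        (F ∆ ⋃₀ 𝒞) ∪ ⋃ D ∈ u, hull D := by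
      rintro x ⟨hxF, hx⟩
      by_cases hxC : x ∈ ⋃₀ 𝒞
      · right
        obtain ⟨C, hC, hxC⟩ := hxC
        have : C ∈ 𝒟 := by
          refine ⟨hC, ?_⟩
          by_contra hcon
          exact hx ⟨C, ⟨h𝒞 hC, not_le.mp hcon⟩, hxC⟩
        obtain ⟨D, hD, hCD⟩ := hcov C this
        exact mem_biUnion hD (hCD hxC)
      · left; exact Or.inl ⟨hxF, hxC⟩
    calc _ ≤ μ (F ∆ ⋃₀ 𝒞) + μ (⋃ D ∈ u, hull D) :=
          (measure_mono hsub).trans (measure_union_le _ _)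
      _ ≤ ε + ∑' D : u, μ (hull D) := by
          gcongr
          exact measure_biUnion_le μ hucnt _
      _ ≤ ε + ∑' D : u, k * μ D := by
          gcongr with D
          exact hb.hull_measure D (h𝒞 (hu D.2).1)
      _ ≤ ε + k * (2 * ε) := by
          rw [ENNReal.tsum_mul_left]
          gcongr
          exact hsum.trans (by gcongr)
      _ = (1 + k * 2) * ε := by ring
  have hC : (1 + k * 2) ≠ ∞ := by
    simp [hk, ENNReal.mul_eq_top]
  have hC0 : (1 + k * 2) ≠ 0 := by simp
  refine le_antisymm (ENNReal.le_of_forall_pos_le_add ?_) bot_le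
  intro ε hε _
  have := key ((1 + k * 2)⁻¹ * ε) (ENNReal.mul_pos (ENNReal.inv_ne_zero.2 hC) (by simpa using hε.ne'))
    (ENNReal.mul_ne_top (ENNReal.inv_ne_top.2 hC0) ENNReal.coe_ne_top)
  rw [← mul_assoc, ENNReal.mul_inv_cancel hC0 hC, one_mul] at this
  simpa using this

lemma step [MeasurableSpace X] {μ : Measure X} {𝔅 : Set (Set X)}
    {hull : Set X → Set X} {K η θ : ℝ} (hb : IsBallBasis μ 𝔅 hull K)
    (hd : IsDoublingBasis μ 𝔅 hull η) (hreg : IsRegularBasis μ 𝔅 hull θ)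
    (k e t σ δ : ℝ≥0∞) (hk : ENNReal.ofReal K ≤ k) (hkt : k ≠ ∞) (hk1 : 1 ≤ k)
    (he : ENNReal.ofReal η = e) (he1 : 1 ≤ e)
    (ht : ENNReal.ofReal θ = t) (hσ0 : σ ≠ 0) (hσ : σ ≤ 1 / 2) (hσδ : σ + δ < t)
    (hq : k * k * e * (σ⁻¹ * δ) ≤ 1 / 2)
    (f : X → ℝ) (hf : Measurable f) (l : ℝ) (hl : 0 < l) (m : Set X → ℝ)
    (hm : ∀ B ∈ 𝔅, μ {x ∈ B | l < |f x - m B|} ≤ δ * μ B)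
    (s : ℝ) (hs : 0 ≤ s) (φ : ℝ≥0∞)
    (hφ : ∀ B ∈ 𝔅, μ {x ∈ B | s < |f x - m B|} ≤ φ * μ B) :
    ∀ B ∈ 𝔅, μ {x ∈ B | s + 2 * l < |f x - m B|} ≤ φ * (1 / 2) * μ B := by
  intro B hB
  have hBt := (hb.measure_lt_top B hB).ne
  have hB0 := (hb.measure_pos B hB).ne'
  have hmeasf : ∀ (a b : ℝ), MeasurableSet {x | a < |f x - b|} := fun a b =>
    measurableSet_lt measurable_const (hf.sub_const b).abs
  set F : Set X := {x ∈ B | l < |f x - m B|} with hF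
  have hFm : MeasurableSet F := (hb.measurableSet B hB).inter (hmeasf _ _)
  have hFδ : μ F ≤ δ * μ B := hm B hB
  have hσt : σ ≠ ∞ := (hσ.trans_lt (by simp)).ne
  have hFt : μ F ≠ ∞ := (measure_mono (fun x hx => hx.1)|>.trans_lt hBt.lt_top).ne
  have hnull := density_null hb F hFm σ hσ
  set 𝒟₀ : Set (Set X) := {D ∈ 𝔅 | σ * μ D < μ (D ∩ F)} with h𝒟₀
  have hsmall : ∀ D ∈ 𝒟₀, μ D ≤ σ⁻¹ * μ (D ∩ F) := by
    intro D hD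
    rw [mul_comm, ← div_eq_mul_inv, ENNReal.le_div_iff_mul_le (Or.inl hσ0) (Or.inl hσt), mul_comm]
    exact hD.2.le
  have hsmallB : ∀ D ∈ 𝒟₀, k * k * e * μ D ≤ 1 / 2 * μ B := by
    intro D hD
    calc k * k * e * μ D ≤ k * k * e * (σ⁻¹ * (δ * μ B)) := by
          gcongr
          exact (hsmall D hD).trans (by gcongr; exact (measure_mono inter_subset_right).trans hFδ)
      _ = k * k * e * (σ⁻¹ * δ) * μ B := by ring
      _ ≤ _ := by gcongr
  have hhalf : 1 / 2 * μ B < μ B := by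
    rw [one_div, mul_comm, ← div_eq_mul_inv]
    exact ENNReal.half_lt_self hB0 hBt
  set 𝒟 : Set (Set X) := {D ∈ 𝒟₀ | ∀ D' ∈ 𝔅, D ⊆ D' → 2 * μ D ≤ μ D' → μ (D' ∩ F) ≤ σ * μ D'}
    with h𝒟
  have hmax : ∀ D ∈ 𝒟₀, ∃ D' ∈ 𝒟, D ⊆ D' := by
    intro D hD
    set M := ⨆ D' : {D' // D' ∈ 𝒟₀ ∧ D ⊆ D'}, μ (D' : Set X) with hM
    have hMt : M ≠ ∞ := by
      have : M ≤ σ⁻¹ * μ F := iSup_le fun D' => (hsmall D' D'.2.1).trans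
        (by gcongr; exact inter_subset_right)
      exact (this.trans_lt (ENNReal.mul_lt_top (ENNReal.inv_lt_top.2 (pos_iff_ne_zero.2 hσ0))
        hFt.lt_top)).ne
    have hM0 : M ≠ 0 := by
      have h1 : μ D ≤ M := le_iSup (fun D' : {D' // D' ∈ 𝒟₀ ∧ D ⊆ D'} => μ (D' : Set X))
        ⟨D, hD, subset_rfl⟩
      exact ((hb.measure_pos D hD.1).trans_le h1).ne'
    obtain ⟨D', hD'⟩ := lt_iSup_iff.1 (ENNReal.half_lt_self hM0 hMt)
    refine ⟨D', ⟨D'.2.1, ?_⟩, D'.2.2⟩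
    intro D'' hD'' hsub h2
    by_contra hcon
    have h3 : μ D'' ≤ M := le_iSup (fun D' : {D' // D' ∈ 𝒟₀ ∧ D ⊆ D'} => μ (D' : Set X))
        ⟨D'', ⟨hD'', not_le.1 hcon⟩, D'.2.2.trans hsub⟩
    have h4 : M < 2 * μ (D' : Set X) := by
      rw [mul_comm]
      exact (ENNReal.div_lt_iff (Or.inl (by norm_num)) (Or.inl (by norm_num))).1 hD'
    exact absurd (h2.trans h3) (not_le.2 h4)
  obtain ⟨u, hu, hucnt, hcov, hsum⟩ := vitali_sel hb 𝒟 (fun D hD => hD.1.1) F hFt σ⁻¹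
    (ENNReal.inv_ne_top.2 hσ0) (fun D hD => hsmall D hD.1)
  have hHull : ∀ D ∈ 𝔅, μ (hull D) ≤ k * μ D := fun D hD =>
    (hb.hull_measure D hD).trans (by gcongr)
  have hself : ∀ D ∈ 𝔅, D ⊆ hull D := fun D hD =>
    hb.subset_hull D hD D hD (by rw [two_mul]; exact le_self_add)
      (by simpa using nonempty_of_measure_ne_zero (hb.measure_pos D hD).ne')
  have hG : ∀ D ∈ 𝒟, ∃ G ∈ 𝔅, hull D ⊆ G ∧ μ G ≤ k * k * e * μ D ∧ |m G - m B| ≤ 2 * l := by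
    intro D hD
    have hD𝔅 : D ∈ 𝔅 := hD.1.1
    have hs1 := hsmallB D hD.1
    have h1 := hb.hull_mem D hD𝔅
    have hne : hull (hull D) ≠ Set.univ := by
      intro hcon
      have : μ B ≤ 1 / 2 * μ B := by
        calc μ B ≤ μ (hull (hull D)) := by rw [hcon]; exact measure_mono (subset_univ _)
          _ ≤ k * (k * μ D) := (hHull _ h1).trans (by gcongr; exact hHull _ hD𝔅)
          _ = k * k * 1 * μ D := by ring
          _ ≤ k * k * e * μ D := by gcongr
          _ ≤ _ := hs1
      exact absurd this (not_le.2 hhalf)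
    obtain ⟨H, hH, hsub, h2, h3⟩ := hd (hull D) h1 hne
    rw [he] at h3
    have hDH : D ⊆ H := (hself D hD𝔅).trans hsub
    have hG𝔅 := hb.hull_mem H hH
    have hHe : μ H ≤ e * (k * μ D) := h3.trans (by gcongr; exact hHull _ hD𝔅)
    have hGsub := hself H hH
    have hHB : μ H ≤ μ B := by
      calc μ H ≤ e * (k * μ D) := hHe
        _ = 1 * k * e * μ D := by ring
        _ ≤ k * k * e * μ D := by gcongr
        _ ≤ _ := hs1.trans hhalf.le
    have hDF : (D ∩ F).Nonempty :=
      nonempty_of_measure_ne_zero (bot_le.trans_lt hD.1.2).ne'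
    have hHBne : (H ∩ B).Nonempty := by
      obtain ⟨x, hx1, hx2⟩ := hDF
      exact ⟨x, hDH hx1, hx2.1⟩
    have hr := hreg B hB H hH hHB hHBne
    rw [ht] at hr
    have hdens : μ (hull H ∩ F) ≤ σ * μ (hull H) := by
      refine hD.2 _ hG𝔅 (hDH.trans hGsub) ?_
      calc 2 * μ D ≤ 2 * μ (hull D) := by gcongr; exact hself D hD𝔅
        _ ≤ μ H := h2
        _ ≤ _ := measure_mono hGsub
    refine ⟨hull H, hG𝔅, hsub.trans hGsub, ?_, ?_⟩
    · calc μ (hull H) ≤ k * (e * (k * μ D)) := (hHull H hH).trans (by gcongr)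
        _ = _ := by ring
    · by_contra hcon
      have hsubs : hull H ∩ B ⊆ (hull H ∩ F) ∪ {x ∈ hull H | l < |f x - m (hull H)|} := by
        rintro x ⟨hxG, hxB⟩
        by_contra hx
        simp only [mem_union, mem_inter_iff, mem_setOf_eq, hF, not_or, not_and, not_lt] at hx
        have a1 := hx.1 hxG hxB
        have a2 := hx.2 hxG
        apply hcon
        have : m (hull H) - m B = (f x - m B) - (f x - m (hull H)) := by ring
        rw [this]
        exact (abs_sub _ _).trans (by linarith)
      have h5 : t * μ (hull H) ≤ (σ + δ) * μ (hull H) := by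
        rw [add_mul]
        exact hr.trans ((measure_mono hsubs).trans ((measure_union_le _ _).trans
          (add_le_add hdens (hm _ hG𝔅))))
      have h6 := (ENNReal.mul_le_mul_iff_left (hb.measure_pos _ hG𝔅).ne'
        (hb.measure_lt_top _ hG𝔅).ne).1 h5
      exact absurd h6 (not_le.2 hσδ)
  choose! G hG1 hG2 hG3 hG4 using hG
  have hsub : {x ∈ B | s + 2 * l < |f x - m B|} ⊆
      (F \ ⋃₀ 𝒟₀) ∪ ⋃ D ∈ u, {x ∈ G D | s < |f x - m (G D)|} := by
    rintro x ⟨hxB, hx⟩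
    have hxF : x ∈ F := ⟨hxB, by linarith⟩
    by_cases hx0 : x ∈ ⋃₀ 𝒟₀
    · right
      obtain ⟨D, hD, hxD⟩ := hx0
      obtain ⟨D', hD', hDD'⟩ := hmax D hD
      obtain ⟨D'', hD'', hDD''⟩ := hcov D' hD'
      refine mem_biUnion hD'' ⟨hG2 D'' (hu hD'') (hDD'' (hDD' hxD)), ?_⟩
      have h4 := hG4 D'' (hu hD'')
      have : f x - m B = (f x - m (G D'')) + (m (G D'') - m B) := by ring
      rw [this] at hx
      have := abs_add_le (f x - m (G D'')) (m (G D'') - m B)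
      linarith
    · left; exact ⟨hxF, hx0⟩
  calc _ ≤ μ (F \ ⋃₀ 𝒟₀) + μ (⋃ D ∈ u, {x ∈ G D | s < |f x - m (G D)|}) :=
        (measure_mono hsub).trans (measure_union_le _ _)
    _ ≤ 0 + ∑' D : u, μ {x ∈ G D | s < |f x - m (G D)|} := by
        rw [hnull]
        gcongr
        exact measure_biUnion_le μ hucnt _
    _ ≤ ∑' D : u, φ * (k * k * e) * μ D := by
        rw [zero_add]
        refine ENNReal.tsum_le_tsum fun D => ?_
        refine (hφ _ (hG1 D (hu D.2))).trans ?_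
        rw [mul_assoc]
        gcongr
        exact hG3 D (hu D.2)
    _ ≤ φ * (k * k * e) * (σ⁻¹ * (δ * μ B)) := by
        rw [ENNReal.tsum_mul_left]
        gcongr
        exact hsum.trans (by gcongr)
    _ = φ * (k * k * e * (σ⁻¹ * δ)) * μ B := by ring
    _ ≤ _ := by gcongr

lemma avgNorm_eq [MeasurableSpace X] (μ : Measure X) (r : ℝ) (hr : 1 ≤ r) (g : X → ℝ)
    (B : Set X) :
    avgNorm μ r g B = eLpNorm g (ENNReal.ofReal r) ((μ B)⁻¹ • μ.restrict B) := by
  have h0 : ENNReal.ofReal r ≠ 0 := by simp; linarith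
  rw [eLpNorm_eq_lintegral_rpow_enorm_toReal h0 ENNReal.ofReal_ne_top,
    ENNReal.toReal_ofReal (by linarith), lintegral_smul_measure, avgNorm]
  simp only [smul_eq_mul, div_eq_mul_inv, Real.enorm_eq_ofReal_abs]
  rw [mul_comm]

lemma prob_norm [MeasurableSpace X] (μ : Measure X) (B : Set X) (h0 : μ B ≠ 0) (ht : μ B ≠ ∞) :
    IsProbabilityMeasure ((μ B)⁻¹ • μ.restrict B) := by
  constructor
  simp [ENNReal.inv_mul_cancel h0 ht]

lemma mean_eq [MeasurableSpace X] (μ : Measure X) (f : X → ℝ) (B : Set X) :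
    mean μ f B = ∫ x, f x ∂((μ B)⁻¹ • μ.restrict B) := by
  rw [integral_smul_measure, mean, ENNReal.toReal_inv, smul_eq_mul, div_eq_inv_mul]

lemma sharp_le [MeasurableSpace X] (μ : Measure X) (r : ℝ) (hr : 1 ≤ r) (f : X → ℝ)
    (hf : Measurable f) (B : Set X) (h0 : μ B ≠ 0) (ht : μ B ≠ ∞) (a : ℝ) :
    sharpNorm μ r f B ≤ 2 * avgNorm μ r (fun x => f x - a) B := by
  have hp := prob_norm μ B h0 ht
  rw [sharpNorm, avgNorm_eq μ r hr, avgNorm_eq μ r hr, mean_eq]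
  set ν := (μ B)⁻¹ • μ.restrict B
  set p := ENNReal.ofReal r with hpdef
  have hp1 : 1 ≤ p := by rw [hpdef]; simpa using hr
  have hp0 : p ≠ 0 := (zero_lt_one.trans_le hp1).ne'
  by_cases hfin : eLpNorm (fun x => f x - a) p ν = ∞
  · rw [hfin]; simp
  have hga : Measurable (fun x => f x - a) := hf.sub_const a
  have hmem : MemLp (fun x => f x - a) p ν := ⟨hga.aestronglyMeasurable, lt_top_iff_ne_top.2 hfin⟩
  have hint : Integrable (fun x => f x - a) ν := hmem.integrable hp1
  have hfint : Integrable f ν := by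
    have h1 := hint.add (integrable_const a)
    have h2 : (fun x => f x - a) + (fun _ => a) = f := by ext x; simp
    rwa [h2] at h1
  set c := ∫ x, f x ∂ν with hc
  have hca : c - a = ∫ x, (f x - a) ∂ν := by
    rw [integral_sub hfint (integrable_const a)]; simp [hc]
  have hle : ‖c - a‖ₑ ≤ eLpNorm (fun x => f x - a) p ν := by
    rw [hca]
    calc _ ≤ ∫⁻ x, ‖f x - a‖ₑ ∂ν := enorm_integral_le_lintegral_enorm _
      _ = eLpNorm (fun x => f x - a) 1 ν := eLpNorm_one_eq_lintegral_enorm.symm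
      _ ≤ _ := eLpNorm_le_eLpNorm_of_exponent_le hp1 hga.aestronglyMeasurable
  have heq : (fun x => f x - c) = (fun x => f x - a) - (fun _ => c - a) := by
    ext x; simp
  rw [heq, two_mul]
  refine (eLpNorm_sub_le hga.aestronglyMeasurable aestronglyMeasurable_const hp1).trans ?_
  gcongr
  rw [eLpNorm_const _ hp0 (IsProbabilityMeasure.ne_zero ν)]
  simpa using hle

lemma alpha_le [MeasurableSpace X] (μ : Measure X) (r : ℝ) (hr : 1 ≤ r) (f : X → ℝ)
    (hf : Measurable f) (B : Set X) (hB : MeasurableSet B) (h0 : μ B ≠ 0) (ht : μ B ≠ ∞)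
    (α : ℝ) (hα0 : 0 < α) (hα : α < 1) (t : ℝ) (hpos : 0 < t)
    (h : sharpNorm μ r f B < ENNReal.ofReal (t * (1 - α))) :
    oscAlpha μ f B α ≤ ENNReal.ofReal (2 * t) := by
  have hp := prob_norm μ B h0 ht
  rw [sharpNorm, avgNorm_eq μ r hr] at h
  set c := mean μ f B
  set ν := (μ B)⁻¹ • μ.restrict B with hν
  have hp1 : 1 ≤ ENNReal.ofReal r := by simpa using hr
  have hgc : Measurable (fun x => f x - c) := hf.sub_const c
  have h1 : eLpNorm (fun x => f x - c) 1 ν < ENNReal.ofReal (t * (1 - α)) :=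
    (eLpNorm_le_eLpNorm_of_exponent_le hp1 hgc.aestronglyMeasurable).trans_lt h
  rw [eLpNorm_one_eq_lintegral_enorm] at h1
  set E : Set X := {x ∈ B | |f x - c| < t} with hE
  set S : Set X := {x | ENNReal.ofReal t ≤ ‖f x - c‖ₑ} with hS
  have hEm : MeasurableSet E := hB.inter (measurableSet_lt hgc.abs measurable_const)
  have h2 := mul_meas_ge_le_lintegral (μ := ν) hgc.enorm (ENNReal.ofReal t)
  have hSm : MeasurableSet S := measurableSet_le measurable_const hgc.enorm
  have h3 : ν S < ENNReal.ofReal (1 - α) := by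
    have h4 := h2.trans_lt h1
    rw [ENNReal.ofReal_mul hpos.le] at h4
    exact lt_of_mul_lt_mul_left' h4
  have h5 : ν E = 1 - ν S := by
    have : ν E = ν Sᶜ := by
      have e : E = Sᶜ ∩ B := by
        ext x
        simp only [hE, hS, mem_setOf_eq, mem_inter_iff, mem_compl_iff, not_le,
          Real.enorm_eq_ofReal_abs, ENNReal.ofReal_lt_ofReal_iff hpos]
        tauto
      rw [hν, Measure.smul_apply, Measure.smul_apply, Measure.restrict_apply hEm,
        Measure.restrict_apply hSm.compl, e, inter_assoc, inter_self]
    rw [this, prob_compl_eq_one_sub hSm]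
  have h6 : ENNReal.ofReal α < ν E := by
    rw [h5, lt_tsub_iff_right]
    calc ENNReal.ofReal α + ν S < ENNReal.ofReal α + ENNReal.ofReal (1 - α) :=
          ENNReal.add_lt_add_left ENNReal.ofReal_ne_top h3
      _ = 1 := by rw [← ENNReal.ofReal_add hα0.le (by linarith)]; simp
  have h7 : ENNReal.ofReal α * μ B < μ E := by
    rw [hν, Measure.smul_apply, Measure.restrict_apply hEm, smul_eq_mul,
      inter_eq_left.2 (fun x hx => hx.1), mul_comm, ← div_eq_mul_inv,
      ENNReal.lt_div_iff_mul_lt (Or.inl h0) (Or.inl ht)] at h6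
    exact h6
  refine (iInf₂_le E ⟨hEm, fun x hx => hx.1, h7⟩).trans ?_
  have hET : μ E ≠ ∞ := (measure_mono (fun x hx => hx.1) |>.trans_lt ht.lt_top).ne
  have : IsFiniteMeasure (μ.restrict E) := ⟨by simpa using hET.lt_top⟩
  refine essSup_le_of_ae_le _ ?_
  have q1 := (Measure.quasiMeasurePreserving_fst (μ := μ.restrict E) (ν := μ.restrict E)).ae
    (ae_restrict_mem hEm)
  have q2 := (Measure.quasiMeasurePreserving_snd (μ := μ.restrict E) (ν := μ.restrict E)).ae
    (ae_restrict_mem hEm)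
  filter_upwards [q1, q2] with p hp1 hp2
  apply ENNReal.ofReal_le_ofReal
  have : f p.1 - f p.2 = (f p.1 - c) - (f p.2 - c) := by ring
  rw [this]
  exact (abs_sub _ _).trans (by linarith [hp1.2, hp2.2])

lemma exists_center [MeasurableSpace X] (μ : Measure X) (f : X → ℝ)
    (B : Set X) (ht : μ B ≠ ∞)
    (α : ℝ) (hα0 : 0 < α) (hα : α < 1) (l : ℝ)
    (h : oscAlpha μ f B α < ENNReal.ofReal l) :
    ∃ m : ℝ, μ {x ∈ B | l < |f x - m|} ≤ ENNReal.ofReal (1 - α) * μ B := by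
  obtain ⟨E, ⟨hEm, hEB, hE⟩, hlt⟩ := by
    simpa only [oscAlpha, iInf_lt_iff, exists_prop] using h
  have hET : μ E ≠ ∞ := (measure_mono hEB |>.trans_lt ht.lt_top).ne
  have : IsFiniteMeasure (μ.restrict E) := ⟨by simpa using hET.lt_top⟩
  have h1 := ae_lt_of_essSup_lt hlt
  have h2 := Measure.ae_ae_of_ae_prod h1
  have hne : μ.restrict E ≠ 0 := by
    intro hcon
    rw [Measure.restrict_eq_zero] at hcon
    simp [hcon] at hE
  have : (ae (μ.restrict E)).NeBot := ae_neBot.2 hne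
  obtain ⟨x, hx⟩ := h2.exists
  refine ⟨f x, ?_⟩
  have h3 : μ ({y | l < |f y - f x|} ∩ E) = 0 := by
    have h4 : ∀ᵐ y ∂μ.restrict E, ¬ (l < |f y - f x|) := by
      filter_upwards [hx] with y hy
      rw [abs_sub_comm]
      have := (ENNReal.ofReal_lt_ofReal_iff_of_nonneg (abs_nonneg _)).1 hy
      exact not_lt.2 this.le
    rw [ae_restrict_iff' hEm, ae_iff] at h4
    convert h4 using 2
    ext y; simp; tauto
  have h5 : {y ∈ B | l < |f y - f x|} ⊆ ({y | l < |f y - f x|} ∩ E) ∪ (B \ E) := by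
    rintro y ⟨hy, hy'⟩
    by_cases hyE : y ∈ E
    · exact Or.inl ⟨hy', hyE⟩
    · exact Or.inr ⟨hy, hyE⟩
  refine (measure_mono h5).trans ((measure_union_le _ _).trans ?_)
  rw [h3, zero_add, measure_sdiff hEB hEm.nullMeasurableSet hET, tsub_le_iff_right]
  calc μ B = ENNReal.ofReal (1 - α) * μ B + ENNReal.ofReal α * μ B := by
        rw [← add_mul, ← ENNReal.ofReal_add (by linarith) hα0.le]; simp
    _ ≤ _ := by gcongr

/-- the constant in the summation. -/
noncomputable def sumC (r : ℝ) : ℝ≥0∞ :=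
  ∑' n : ℕ, ENNReal.ofReal (2 * (n + 1)) ^ r * (1 / 2) ^ n

lemma sumC_ne_top (r : ℝ) (hr : 1 ≤ r) : sumC r ≠ ∞ := by
  obtain ⟨N, hN⟩ := exists_nat_ge r
  have hs : Summable (fun n : ℕ => (2 * ((n : ℝ) + 1)) ^ N * (1 / 2 : ℝ) ^ n) := by
    have h1 := summable_pow_mul_geometric_of_norm_lt_one (R := ℝ) N (r := 1 / 2) (by norm_num)
    have h2 := (summable_nat_add_iff 1).2 h1
    have h3 := h2.mul_left (2 ^ N * 2)
    refine h3.congr fun n => ?_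
    push_cast
    rw [mul_pow, pow_succ (1 / 2 : ℝ)]
    ring
  have hle : sumC r ≤ ∑' n : ℕ, ENNReal.ofReal ((2 * ((n : ℝ) + 1)) ^ N * (1 / 2 : ℝ) ^ n) := by
    refine ENNReal.tsum_le_tsum fun n => ?_
    rw [ENNReal.ofReal_mul (p := (2 * ((n : ℝ) + 1)) ^ N) (by positivity),
      ENNReal.ofReal_pow (p := 1 / 2) (by norm_num)]
    have : ENNReal.ofReal (1 / 2) = 1 / 2 := by
      rw [ENNReal.ofReal_div_of_pos (by norm_num)]; simp
    rw [this, ENNReal.ofReal_rpow_of_pos (by positivity)]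
    gcongr
    rw [← Real.rpow_natCast]
    exact Real.rpow_le_rpow_of_exponent_le (by linarith [(Nat.cast_nonneg n : (0:ℝ) ≤ n)]) hN
  rw [← ENNReal.ofReal_tsum_of_nonneg (fun n => by positivity) hs] at hle
  exact (hle.trans_lt ENNReal.ofReal_lt_top).ne

lemma sumC_pos (r : ℝ) : sumC r ≠ 0 := by
  intro h
  have := ENNReal.tsum_eq_zero.1 h 0
  simp at this

lemma avg_le [MeasurableSpace X] (μ : Measure X) (r : ℝ) (hr : 1 ≤ r) (g : X → ℝ)
    (hg : Measurable g) (B : Set X) (hB : MeasurableSet B) (h0 : μ B ≠ 0) (ht : μ B ≠ ∞)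
    (l : ℝ) (hl : 0 < l)
    (h : ∀ n : ℕ, μ {x ∈ B | n * (2 * l) < |g x|} ≤ (1 / 2) ^ n * μ B) :
    avgNorm μ r g B ≤ ENNReal.ofReal l * sumC r ^ (1 / r) := by
  have hr0 : 0 < r := by linarith
  have hpt : ∀ x, ENNReal.ofReal |g x| ^ r ≤ ∑' n : ℕ,
      ({x | n * (2 * l) < |g x|} : Set X).indicator
        (fun _ => ENNReal.ofReal (l * (2 * (n + 1))) ^ r) x := by
    intro x
    by_cases hx : |g x| = 0
    · simp [hx, hr0]
    have hpos : 0 < |g x| := lt_of_le_of_ne (abs_nonneg _) (Ne.symm hx)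
    set y := |g x| / (2 * l) with hy
    have hy0 : 0 < y := by positivity
    obtain ⟨n, hn⟩ : ∃ n, ⌈y⌉₊ = n + 1 := Nat.exists_eq_succ_of_ne_zero (Nat.ceil_pos.2 hy0).ne'
    have a1 : y ≤ n + 1 := by
      have := Nat.le_ceil y
      rw [hn] at this; exact_mod_cast this
    have a2 : (n : ℝ) < y := by
      have := Nat.ceil_lt_add_one hy0.le
      rw [hn] at this; push_cast at this; linarith
    have b1 : |g x| ≤ l * (2 * (n + 1)) := by
      rw [hy, div_le_iff₀ (by positivity)] at a1; linarith
    have b2 : n * (2 * l) < |g x| := by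
      rw [hy, lt_div_iff₀ (by positivity)] at a2; linarith
    refine le_trans ?_ (ENNReal.le_tsum n)
    rw [indicator_of_mem (show x ∈ {x | n * (2 * l) < |g x|} from b2)]
    gcongr
  have hms : ∀ n : ℕ, MeasurableSet {x | n * (2 * l) < |g x|} := fun n =>
    measurableSet_lt measurable_const hg.abs
  have hint : ∫⁻ x in B, ENNReal.ofReal |g x| ^ r ∂μ ≤ ENNReal.ofReal l ^ r * sumC r * μ B := by
    calc _ ≤ ∫⁻ x in B, ∑' n : ℕ, ({x | n * (2 * l) < |g x|} : Set X).indicator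
            (fun _ => ENNReal.ofReal (l * (2 * (n + 1))) ^ r) x ∂μ := lintegral_mono hpt
      _ = ∑' n : ℕ, ∫⁻ x in B, ({x | n * (2 * l) < |g x|} : Set X).indicator
            (fun _ => ENNReal.ofReal (l * (2 * (n + 1))) ^ r) x ∂μ :=
          lintegral_tsum fun n => (measurable_const.indicator (hms n)).aemeasurable
      _ ≤ ∑' n : ℕ, ENNReal.ofReal l ^ r * (ENNReal.ofReal (2 * (n + 1)) ^ r * (1 / 2) ^ n) * μ B := by
          refine ENNReal.tsum_le_tsum fun n => ?_
          rw [lintegral_indicator_const (hms n), Measure.restrict_apply (hms n),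
            ENNReal.ofReal_mul hl.le, ENNReal.mul_rpow_of_nonneg _ _ hr0.le, inter_comm]
          have := h n
          calc _ ≤ ENNReal.ofReal l ^ r * ENNReal.ofReal (2 * (n + 1)) ^ r * ((1 / 2) ^ n * μ B) := by
                gcongr; exact this
            _ = _ := by ring
      _ = _ := by rw [ENNReal.tsum_mul_right, ENNReal.tsum_mul_left, sumC]
  have hdiv : (∫⁻ x in B, ENNReal.ofReal |g x| ^ r ∂μ) / μ B ≤ ENNReal.ofReal l ^ r * sumC r := by
    rw [ENNReal.div_le_iff h0 ht]; exact hint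
  calc avgNorm μ r g B ≤ (ENNReal.ofReal l ^ r * sumC r) ^ (1 / r) := by
        rw [avgNorm]; gcongr
    _ = _ := by
        rw [ENNReal.mul_rpow_of_nonneg _ _ (by positivity), ← ENNReal.rpow_mul,
          mul_one_div_cancel hr0.ne', ENNReal.rpow_one]

theorem bmoAlpha_eq_bmo
    (K η θ r : ℝ) (hK : 0 < K) (hη : 2 < η) (hθ : 0 < θ) (hθ1 : θ < 1) (hr : 1 ≤ r) :
    ∃ α : ℝ, 1 / 2 < α ∧ α < 1 ∧
      ∃ c₁ c₂ : ℝ≥0∞, 0 < c₁ ∧ c₁ ≠ ∞ ∧ 0 < c₂ ∧ c₂ ≠ ∞ ∧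
        ∀ (X : Type) (_ : MeasurableSpace X) (μ : Measure X)
          (𝔅 : Set (Set X)) (hull : Set X → Set X),
          IsBallBasis μ 𝔅 hull K →
          IsDoublingBasis μ 𝔅 hull η →
          IsRegularBasis μ 𝔅 hull θ →
          ∀ f : X → ℝ, Measurable f →
            (bmoAlphaNorm μ 𝔅 α f ≠ ∞ ↔ bmoNorm μ 𝔅 r f ≠ ∞) ∧
            (bmoAlphaNorm μ 𝔅 α f ≠ ∞ →
              c₁ * bmoAlphaNorm μ 𝔅 α f ≤ bmoNorm μ 𝔅 r f ∧
              bmoNorm μ 𝔅 r f ≤ c₂ * bmoAlphaNorm μ 𝔅 α f) := by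
  set k : ℝ := max K 1 with hkdef
  have hk1 : 1 ≤ k := le_max_right _ _
  set δ : ℝ := θ / (4 * (k * k * η)) with hδ
  have hkk : 1 ≤ k * k := by nlinarith
  have hkη : 2 < k * k * η := by nlinarith
  have hδ0 : 0 < δ := by positivity
  have hδ1 : δ < θ / 2 := by
    rw [hδ, div_lt_div_iff₀ (by positivity) (by norm_num)]; nlinarith
  have hα0 : 0 < 1 - δ := by linarith
  have hα1 : 1 - δ < 1 := by linarith
  refine ⟨1 - δ, by linarith, hα1, ENNReal.ofReal (δ / 2), 2 * sumC r ^ (1 / r),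
    by simpa using hδ0, ENNReal.ofReal_ne_top, ?_, ?_, ?_⟩
  · refine ENNReal.mul_pos (by norm_num) ?_
    simp [ENNReal.rpow_eq_zero_iff, sumC_pos, sumC_ne_top r hr]
  · refine ENNReal.mul_ne_top (by norm_num) (ENNReal.rpow_ne_top_of_nonneg (by positivity)
      (sumC_ne_top r hr))
  intro X _ μ 𝔅 hull hb hd hreg f hf
  have hC1 : ENNReal.ofReal (δ / 2) * bmoAlphaNorm μ 𝔅 (1 - δ) f ≤ bmoNorm μ 𝔅 r f := by
    refine le_of_forall_gt fun M hM => ?_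
    obtain ⟨q, hq1, hq2⟩ := exists_between hM
    have hqt : q ≠ ∞ := (hq2.trans_le le_top).ne
    have hq0 : 0 < q.toReal := ENNReal.toReal_pos (bot_le.trans_lt hq1).ne' hqt
    refine lt_of_le_of_lt ?_ hq2
    have h1 : bmoAlphaNorm μ 𝔅 (1 - δ) f ≤ ENNReal.ofReal (2 * (q.toReal / δ)) := by
      refine iSup₂_le fun B hB => ?_
      refine alpha_le μ r hr f hf B (hb.measurableSet B hB) (hb.measure_pos B hB).ne'
        (hb.measure_lt_top B hB).ne _ hα0 hα1 _ (by positivity) ?_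
      have e : q.toReal / δ * (1 - (1 - δ)) = q.toReal := by field_simp; ring
      rw [e, ENNReal.ofReal_toReal hqt]
      exact (le_iSup₂ (f := fun B (_ : B ∈ 𝔅) => sharpNorm μ r f B) B hB).trans_lt hq1
    calc _ ≤ ENNReal.ofReal (δ / 2) * ENNReal.ofReal (2 * (q.toReal / δ)) := by gcongr
      _ = q := by
        rw [← ENNReal.ofReal_mul (by positivity)]
        have e : δ / 2 * (2 * (q.toReal / δ)) = q.toReal := by field_simp
        rw [e, ENNReal.ofReal_toReal hqt]
  have hC2' : ∀ l : ℝ, 0 < l → bmoAlphaNorm μ 𝔅 (1 - δ) f < ENNReal.ofReal l →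
      bmoNorm μ 𝔅 r f ≤ 2 * sumC r ^ (1 / r) * ENNReal.ofReal l := by
    intro l hl hlt
    have hm : ∀ B ∈ 𝔅, ∃ m : ℝ, μ {x ∈ B | l < |f x - m|} ≤ ENNReal.ofReal δ * μ B := by
      intro B hB
      have := exists_center μ f B (hb.measure_lt_top B hB).ne (1 - δ) hα0 hα1 l
        ((le_iSup₂ (f := fun B (_ : B ∈ 𝔅) => oscAlpha μ f B (1 - δ)) B hB).trans_lt hlt)
      simpa using this
    choose! m hm using hm
    have hiter : ∀ n : ℕ, ∀ B ∈ 𝔅, μ {x ∈ B | n * (2 * l) < |f x - m B|} ≤ (1 / 2) ^ n * μ B := by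
      intro n
      induction n with
      | zero =>
        intro B hB
        rw [pow_zero, one_mul]
        exact measure_mono fun x hx => hx.1
      | succ n ih =>
        intro B hB
        have := step hb hd hreg (ENNReal.ofReal k) (ENNReal.ofReal η) (ENNReal.ofReal θ)
          (ENNReal.ofReal (θ / 2)) (ENNReal.ofReal δ)
          (ENNReal.ofReal_le_ofReal (le_max_left _ _)) ENNReal.ofReal_ne_top
          (by simpa using hk1) rfl (by simp; linarith) rfl (by simpa using hθ) ?_ ?_ ?_
          f hf l hl m hm (n * (2 * l)) (by positivity) ((1 / 2) ^ n) ih B hB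
        · rw [pow_succ]
          convert this using 6
          push_cast; ring
        · have : ENNReal.ofReal (1 / 2) = 1 / 2 := by
            rw [ENNReal.ofReal_div_of_pos (by norm_num)]; simp
          rw [← this]
          exact ENNReal.ofReal_le_ofReal (by linarith)
        · rw [← ENNReal.ofReal_add (by positivity) (by positivity)]
          exact (ENNReal.ofReal_lt_ofReal_iff hθ).2 (by linarith)
        · rw [← ENNReal.ofReal_inv_of_pos (by positivity), ← ENNReal.ofReal_mul (by positivity),
            ← ENNReal.ofReal_mul (by positivity), ← ENNReal.ofReal_mul (by positivity),
            ← ENNReal.ofReal_mul (by positivity)]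
          have : ENNReal.ofReal (1 / 2) = 1 / 2 := by
            rw [ENNReal.ofReal_div_of_pos (by norm_num)]; simp
          rw [← this]
          refine ENNReal.ofReal_le_ofReal (le_of_eq ?_)
          rw [hδ]
          have : k ≠ 0 := by positivity
          field_simp
          norm_num
    refine iSup₂_le fun B hB => ?_
    have h0 := (hb.measure_pos B hB).ne'
    have ht := (hb.measure_lt_top B hB).ne
    refine (sharp_le μ r hr f hf B h0 ht (m B)).trans ?_
    rw [mul_assoc, mul_comm (sumC r ^ (1 / r))]
    gcongr
    exact avg_le μ r hr _ (hf.sub_const _) B (hb.measurableSet B hB) h0 ht l hl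
      (fun n => hiter n B hB)
  have hCt : (2 * sumC r ^ (1 / r)) ≠ ∞ := ENNReal.mul_ne_top (by norm_num)
    (ENNReal.rpow_ne_top_of_nonneg (by positivity) (sumC_ne_top r hr))
  have hC0 : (2 * sumC r ^ (1 / r)) ≠ 0 := by
    refine mul_ne_zero (by norm_num) ?_
    simp [ENNReal.rpow_eq_zero_iff, sumC_pos, sumC_ne_top r hr]
  have hC2 : bmoAlphaNorm μ 𝔅 (1 - δ) f ≠ ∞ →
      bmoNorm μ 𝔅 r f ≤ 2 * sumC r ^ (1 / r) * bmoAlphaNorm μ 𝔅 (1 - δ) f := by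
    intro hfin
    rw [mul_comm, ← ENNReal.div_le_iff hC0 hCt]
    refine le_of_forall_gt fun M hM => ?_
    obtain ⟨q, hq1, hq2⟩ := exists_between hM
    have hqt : q ≠ ∞ := (hq2.trans_le le_top).ne
    have hq0 : 0 < q.toReal := ENNReal.toReal_pos (bot_le.trans_lt hq1).ne' hqt
    refine lt_of_le_of_lt ?_ hq2
    rw [ENNReal.div_le_iff hC0 hCt, mul_comm]
    have := hC2' q.toReal hq0 (by rwa [ENNReal.ofReal_toReal hqt])
    rwa [ENNReal.ofReal_toReal hqt] at this
  refine ⟨⟨fun h => ?_, fun h hcon => ?_⟩, fun h => ⟨hC1, hC2 h⟩⟩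
  · exact ((hC2 h).trans_lt (ENNReal.mul_lt_top hCt.lt_top h.lt_top)).ne
  · rw [hcon, ENNReal.mul_top (by simpa using hδ0)] at hC1
    exact h (top_le_iff.1 hC1)
end

section
/- There is a constant c > 0 depending only on the dimension d such that for every f ∈ BMO(ℝ^d), every Euclidean ball B ⊆ ℝ^d, and every integer n ≥ 1, one has |{x ∈ B : |f(x) − f_B| > c(n+1)‖f‖_BMO}| ≤ (1/2) · |{x ∈ B : |f(x) − f_B| > cn‖f‖_BMO}|, where |·| denotes Lebesgue measure. -/
open MeasureTheory Metric
open scoped ENNReal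

/-- the mean of `f` over a set `B ⊆ ℝ^d`. -/
noncomputable def ballMean {d : ℕ} (f : EuclideanSpace ℝ (Fin d) → ℝ)
    (B : Set (EuclideanSpace ℝ (Fin d))) : ℝ :=
  (∫ x in B, f x) / (volume B).toReal

/-- the `BMO(ℝ^d)` norm (`L¹` mean oscillation over Euclidean balls). -/
noncomputable def bmoNormRd {d : ℕ} (f : EuclideanSpace ℝ (Fin d) → ℝ) : ℝ≥0∞ :=
  ⨆ (z : EuclideanSpace ℝ (Fin d)) (R : ℝ) (_ : 0 < R),
    (∫⁻ x in ball z R, ENNReal.ofReal |f x - ballMean f (ball z R)|) / volume (ball z R)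

theorem jn_ball {d : ℕ} (w : EuclideanSpace ℝ (Fin d)) {r : ℝ} (hr : 0 < r) :
    volume.real (ball w r) = r ^ d * volume.real (ball (0 : EuclideanSpace ℝ (Fin d)) 1) := by
  rw [Measure.real, Measure.addHaar_ball_of_pos _ _ hr, ENNReal.toReal_mul,
    ENNReal.toReal_ofReal (by positivity), finrank_euclideanSpace, Fintype.card_fin, Measure.real]

open Filter Topology in
theorem jn_selection {d : ℕ} (z : EuclideanSpace ℝ (Fin d)) (R : ℝ) (hR : 0 < R)
    (E : Set (EuclideanSpace ℝ (Fin d)))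
    (hE : volume.real (E ∩ closedBall z R) ≤ 1 / 2 * volume.real (ball z R)) :
    ∀ᵐ x ∂(volume.restrict E), x ∈ ball z R → ∃ (w : EuclideanSpace ℝ (Fin d)) (r : ℝ),
      0 < r ∧ r ≤ R ∧ x ∈ closedBall w r ∧ ball w r ⊆ ball z R ∧
      volume.real (ball w r) ≤ 2 ^ (d + 1) * volume.real (E ∩ closedBall w r) ∧
      volume.real (E ∩ closedBall w r) ≤ 1 / 2 * volume.real (ball w r) := by
  filter_upwards [IsUnifLocDoublingMeasure.ae_tendsto_measure_inter_div
    (volume : Measure (EuclideanSpace ℝ (Fin d))) E 1] with x hx hxB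
  set w : ℕ → EuclideanSpace ℝ (Fin d) := fun k => x + ((1 / 2 : ℝ) ^ k) • (z - x) with hw
  set δ : ℕ → ℝ := fun k => (1 / 2 : ℝ) ^ k * R with hδ
  have hδpos : ∀ k, 0 < δ k := fun k => by simp only [hδ]; positivity
  have hzx : ‖z - x‖ < R := by rwa [mem_ball', dist_eq_norm] at hxB
  have hxw : ∀ k, x ∈ closedBall (w k) (δ k) := fun k => by
    rw [mem_closedBall', dist_eq_norm]
    simp only [hw, hδ, add_sub_cancel_left, norm_smul]
    rw [Real.norm_of_nonneg (by positivity)]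
    gcongr
  have hlim : Tendsto δ atTop (𝓝[>] 0) := by
    refine tendsto_nhdsWithin_iff.2 ⟨?_, Eventually.of_forall fun k => hδpos k⟩
    have := (tendsto_pow_atTop_nhds_zero_of_lt_one (r := (1 / 2 : ℝ)) (by norm_num)
      (by norm_num)).mul_const R
    simpa [hδ] using this
  have hT := hx w δ hlim (Eventually.of_forall fun k => by simpa using hxw k)
  have hcb : ∀ (y : EuclideanSpace ℝ (Fin d)) (r : ℝ), 0 < r →
      volume (closedBall y r) = volume (ball y r) := fun y r hr => by
    rw [Measure.addHaar_closedBall _ _ hr.le, Measure.addHaar_ball_of_pos _ _ hr]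
  have hhalf : ∃ k, 1 / 2 * volume.real (ball (w k) (δ k)) <
      volume.real (E ∩ closedBall (w k) (δ k)) := by
    have h1 : (1 / 2 : ℝ≥0∞) < 1 := by simp
    obtain ⟨k, hk⟩ := (hT.eventually (lt_mem_nhds h1)).exists
    refine ⟨k, ?_⟩
    rw [hcb _ _ (hδpos k)] at hk
    have hk2 := ENNReal.mul_lt_of_lt_div hk
    have hfin : volume (E ∩ closedBall (w k) (δ k)) ≠ ∞ :=
      measure_ne_top_of_subset Set.inter_subset_right measure_closedBall_lt_top.ne
    have := (ENNReal.toReal_lt_toReal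
      (ENNReal.mul_ne_top (by simp) measure_ball_lt_top.ne) hfin).2 hk2
    simpa [Measure.real] using this
  classical
  have hmin := Nat.find_spec hhalf
  have hlow : ∀ j < Nat.find hhalf, _ := fun j hj => Nat.find_min hhalf hj
  generalize Nat.find hhalf = k at hmin hlow
  have hw0 : w 0 = z := by simp [hw]
  have hδ0 : δ 0 = R := by simp [hδ]
  cases k with
  | zero => rw [hw0, hδ0] at hmin; linarith
  | succ k =>
    have hk := not_lt.1 (hlow k (Nat.lt_succ_self k))
    have hδs : δ (k + 1) = δ k / 2 := by simp only [hδ, pow_succ]; ring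
    have hdist : dist (w (k + 1)) (w k) ≤ δ k / 2 := by
      rw [dist_comm, dist_eq_norm]
      have : w k - w (k + 1) = ((1 / 2 : ℝ) ^ (k + 1)) • (z - x) := by
        simp only [hw, add_sub_add_left_eq_sub, ← sub_smul]
        congr 1
        rw [pow_succ]; ring
      rw [this, norm_smul, Real.norm_of_nonneg (by positivity), ← hδs]
      simp only [hδ]; gcongr
    have hsub : closedBall (w (k + 1)) (δ (k + 1)) ⊆ closedBall (w k) (δ k) :=
      closedBall_subset_closedBall' (by linarith)
    have hle1 : ((1 / 2 : ℝ) ^ k) ≤ 1 := pow_le_one₀ (by norm_num) (by norm_num)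
    refine ⟨w k, δ k, hδpos k, ?_, hxw k, ?_, ?_, hk⟩
    · simp only [hδ]; nlinarith
    · apply ball_subset_ball'
      have : w k - z = (1 - (1 / 2 : ℝ) ^ k) • (x - z) := by
        simp only [hw]; module
      rw [dist_eq_norm, this, norm_smul, Real.norm_of_nonneg (by linarith), norm_sub_rev]
      simp only [hδ]
      nlinarith
    · have hv : volume.real (ball (w k) (δ k)) =
          2 ^ d * volume.real (ball (w (k + 1)) (δ (k + 1))) := by
        rw [jn_ball _ (hδpos _),
          jn_ball _ (hδpos _), hδs]
        simp only [finrank_euclideanSpace, Fintype.card_fin, div_pow]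
        field_simp
      have hm : volume.real (E ∩ closedBall (w (k + 1)) (δ (k + 1))) ≤
          volume.real (E ∩ closedBall (w k) (δ k)) :=
        measureReal_mono (Set.inter_subset_inter_right _ hsub)
          (measure_ne_top_of_subset Set.inter_subset_right measure_closedBall_lt_top.ne)
      rw [hv, pow_succ, mul_assoc]
      gcongr
      linarith

theorem jn_cheb {d : ℕ} (f : EuclideanSpace ℝ (Fin d) → ℝ) (hf : LocallyIntegrable f volume)
    (hb : bmoNormRd f ≠ ∞) (z : EuclideanSpace ℝ (Fin d)) (R : ℝ) (hR : 0 < R)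
    (t : ℝ) (ht : 0 ≤ t) (S : Set (EuclideanSpace ℝ (Fin d))) (hS : S ⊆ ball z R)
    (hSt : ∀ x ∈ S, t ≤ |f x - ballMean f (ball z R)|) :
    t * volume.real S ≤ (bmoNormRd f).toReal * volume.real (ball z R) := by
  have h1 : (∫⁻ x in ball z R, ENNReal.ofReal |f x - ballMean f (ball z R)|)
      / volume (ball z R) ≤ bmoNormRd f :=
    le_iSup_of_le z (le_iSup_of_le R (le_iSup_of_le hR le_rfl))
  have hpos : volume (ball z R) ≠ 0 := (measure_ball_pos _ _ hR).ne'
  have hfin : volume (ball z R) ≠ ∞ := measure_ball_lt_top.ne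
  rw [ENNReal.div_le_iff hpos hfin] at h1
  have hm : AEMeasurable (fun x => ENNReal.ofReal |f x - ballMean f (ball z R)|)
      (volume.restrict (ball z R)) := by
    have := hf.aestronglyMeasurable.aemeasurable.restrict (s := ball z R)
    exact ((this.sub_const _).norm).ennreal_ofReal
  have h2 := mul_meas_ge_le_lintegral₀ hm (ENNReal.ofReal t)
  have h3 : volume S ≤ volume.restrict (ball z R)
      {x | ENNReal.ofReal t ≤ ENNReal.ofReal |f x - ballMean f (ball z R)|} := by
    rw [Measure.restrict_apply' measurableSet_ball]
    exact measure_mono fun x hx => ⟨ENNReal.ofReal_le_ofReal (hSt x hx), hS hx⟩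
  have h4 : ENNReal.ofReal t * volume S ≤ bmoNormRd f * volume (ball z R) :=
    (mul_le_mul_right h3 _).trans (h2.trans h1)
  have := ENNReal.toReal_mono (ENNReal.mul_ne_top hb hfin) h4
  simpa [Measure.real, ENNReal.toReal_mul, ENNReal.toReal_ofReal ht] using this

theorem jn_local {d : ℕ} (f : EuclideanSpace ℝ (Fin d) → ℝ) (hf : LocallyIntegrable f volume)
    (hb : bmoNormRd f ≠ ∞) (hM : 0 < (bmoNormRd f).toReal)
    (B : Set (EuclideanSpace ℝ (Fin d))) (a lam c : ℝ)
    (hc : c = 3 * 5 ^ d + 5 ^ d * 2 ^ (d + 2))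
    (w : EuclideanSpace ℝ (Fin d)) (r : ℝ) (hr : 0 < r) (hsub : ball w r ⊆ B)
    (h1 : volume.real (ball w r) ≤
      2 ^ (d + 1) * volume.real ({x ∈ B | lam < |f x - a|} ∩ closedBall w r))
    (h2 : volume.real ({x ∈ B | lam < |f x - a|} ∩ closedBall w r) ≤
      1 / 2 * volume.real (ball w r)) :
    volume ({x ∈ B | lam + c * (bmoNormRd f).toReal < |f x - a|} ∩ closedBall w (4 * r)) ≤
      2⁻¹ * volume ({x ∈ B | lam < |f x - a|} ∩ closedBall w r) := by
  set M := (bmoNormRd f).toReal with hMdef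
  set E := {x ∈ B | lam < |f x - a|} with hE
  set m := ballMean f (ball w (5 * r)) with hm
  set p := volume.real (ball w r) with hp
  have hppos : 0 < p := by
    rw [hp, Measure.real]
    exact ENNReal.toReal_pos (measure_ball_pos _ _ hr).ne' measure_ball_lt_top.ne
  have h5 : volume.real (ball w (5 * r)) = 5 ^ d * p := by
    rw [hp, jn_ball _ hr,
      jn_ball _ (by positivity : 0 < 5 * r)]
    simp only [finrank_euclideanSpace, Fintype.card_fin, mul_pow]
    ring
  have hma : |m - a| ≤ lam + 3 * 5 ^ d * M := by
    by_contra hcon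
    push Not at hcon
    have hch := jn_cheb f hf hb w (5 * r) (by positivity) (3 * 5 ^ d * M) (by positivity)
      (ball w r \ E) (Set.sdiff_subset.trans (ball_subset_ball (by linarith))) (by
        intro x hx
        have hx2 : |f x - a| ≤ lam := by
          by_contra hcc
          exact hx.2 ⟨hsub hx.1, not_le.1 hcc⟩
        have := abs_sub_le m (f x) a
        rw [abs_sub_comm m (f x)] at this
        linarith)
    have hd : p ≤ volume.real (E ∩ closedBall w r) + volume.real (ball w r \ E) := by
      refine (measureReal_mono (s₂ := (E ∩ closedBall w r) ∪ (ball w r \ E)) ?_ ?_).trans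
        (measureReal_union_le _ _)
      · intro x hx
        by_cases hxE : x ∈ E
        · exact Or.inl ⟨hxE, ball_subset_closedBall hx⟩
        · exact Or.inr ⟨hx, hxE⟩
      · refine measure_ne_top_of_subset (?_ : _ ⊆ closedBall w r) measure_closedBall_lt_top.ne
        exact Set.union_subset Set.inter_subset_right
          (Set.sdiff_subset.trans ball_subset_closedBall)
    rw [h5] at hch
    have hq : 1 / 2 * p ≤ volume.real (ball w r \ E) := by linarith
    have h6 : 3 * 5 ^ d * M * (1 / 2 * p) ≤ M * (5 ^ d * p) :=
      (mul_le_mul_of_nonneg_left hq (by positivity)).trans hch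
    have h7 : 0 < M * (5 ^ d * p) := by positivity
    nlinarith
  have hch := jn_cheb f hf hb w (5 * r) (by positivity) (5 ^ d * 2 ^ (d + 2) * M) (by positivity)
      ({x ∈ B | lam + c * M < |f x - a|} ∩ closedBall w (4 * r))
      (Set.inter_subset_right.trans (closedBall_subset_ball (by linarith))) (by
        rintro x ⟨⟨_, hx⟩, _⟩
        have := abs_sub_le (f x) m a
        rw [hc] at hx
        simp only [← hm]
        nlinarith)
  rw [h5] at hch
  set s := volume.real ({x ∈ B | lam + c * M < |f x - a|} ∩ closedBall w (4 * r)) with hs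
  have hfin1 : volume ({x ∈ B | lam + c * M < |f x - a|} ∩ closedBall w (4 * r)) ≠ ∞ :=
    measure_ne_top_of_subset Set.inter_subset_right measure_closedBall_lt_top.ne
  have hfin2 : volume (E ∩ closedBall w r) ≠ ∞ :=
    measure_ne_top_of_subset Set.inter_subset_right measure_closedBall_lt_top.ne
  have h8 : 2 ^ (d + 2) * s ≤ p := by
    have h9 : 0 < M * 5 ^ d := by positivity
    refine le_of_mul_le_mul_left ?_ h9
    calc _ = 5 ^ d * 2 ^ (d + 2) * M * s := by ring
      _ ≤ _ := hch
      _ = _ := by ring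
  have h10 : s ≤ 2⁻¹ * volume.real (E ∩ closedBall w r) := by
    have h9 : (0 : ℝ) < 2 ^ (d + 1) := by positivity
    have h11 := h8.trans h1
    rw [pow_succ _ (d + 1), mul_assoc] at h11
    have := le_of_mul_le_mul_left h11 h9
    linarith
  rw [← ENNReal.toReal_le_toReal hfin1 (ENNReal.mul_ne_top (by simp) hfin2)]
  simpa [Measure.real, hs] using h10

theorem jn_pos {d : ℕ} (f : EuclideanSpace ℝ (Fin d) → ℝ) (hf : LocallyIntegrable f volume)
    (hb : bmoNormRd f ≠ ∞) (hM : 0 < (bmoNormRd f).toReal)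
    (z : EuclideanSpace ℝ (Fin d)) (R : ℝ) (hR : 0 < R) (lam c : ℝ)
    (hc : c = 3 * 5 ^ d + 5 ^ d * 2 ^ (d + 2)) (hlam : c * (bmoNormRd f).toReal ≤ lam) :
    volume {x ∈ ball z R | lam + c * (bmoNormRd f).toReal < |f x - ballMean f (ball z R)|} ≤
      2⁻¹ * volume {x ∈ ball z R | lam < |f x - ballMean f (ball z R)|} := by
  set M := (bmoNormRd f).toReal with hMdef
  set a := ballMean f (ball z R) with ha
  set E := {x ∈ ball z R | lam < |f x - a|} with hE
  set F := {x ∈ ball z R | lam + c * M < |f x - a|} with hF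
  have hc2 : 2 ≤ c := by
    have h1 : (1 : ℝ) ≤ 5 ^ d := one_le_pow₀ (by norm_num)
    have h2 : (0 : ℝ) ≤ 5 ^ d * 2 ^ (d + 2) := by positivity
    linarith
  have hFE : F ⊆ E := fun x hx => ⟨hx.1, by have := hx.2; nlinarith⟩
  have hEfin : volume E ≠ ∞ :=
    measure_ne_top_of_subset (Set.sep_subset _ _) measure_ball_lt_top.ne
  have hhalf : volume.real (E ∩ closedBall z R) ≤ 1 / 2 * volume.real (ball z R) := by
    have hch := jn_cheb f hf hb z R hR (2 * M) (by positivity) (E ∩ closedBall z R)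
      (fun x hx => hx.1.1) (fun x hx => by
        have h1 : lam < |f x - a| := hx.1.2
        have : 2 * M ≤ c * M := by gcongr
        simp only [← ha]; linarith)
    refine le_of_mul_le_mul_left ?_ (by positivity : 0 < 2 * M)
    calc _ ≤ _ := hch
      _ = _ := by ring
  have hsel := jn_selection z R hR E hhalf
  set G : Set (EuclideanSpace ℝ (Fin d)) := {x | x ∈ ball z R → ∃ (w : EuclideanSpace ℝ (Fin d)) (r : ℝ),
      0 < r ∧ r ≤ R ∧ x ∈ closedBall w r ∧ ball w r ⊆ ball z R ∧
      volume.real (ball w r) ≤ 2 ^ (d + 1) * volume.real (E ∩ closedBall w r) ∧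
      volume.real (E ∩ closedBall w r) ≤ 1 / 2 * volume.real (ball w r)} with hG
  have hnull : volume (Gᶜ ∩ E) = 0 :=
    le_antisymm ((Measure.le_restrict_apply _ _).trans (le_of_eq (mem_ae_iff.1 hsel))) zero_le
  have hsel2 : ∀ x : EuclideanSpace ℝ (Fin d), ∃ (w : EuclideanSpace ℝ (Fin d)) (r : ℝ),
      x ∈ G ∩ E →
      0 < r ∧ r ≤ R ∧ x ∈ closedBall w r ∧ ball w r ⊆ ball z R ∧
      volume.real (ball w r) ≤ 2 ^ (d + 1) * volume.real (E ∩ closedBall w r) ∧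
      volume.real (E ∩ closedBall w r) ≤ 1 / 2 * volume.real (ball w r) := by
    intro x
    by_cases hx : x ∈ G ∩ E
    · obtain ⟨w, r, h⟩ := hx.1 hx.2.1
      exact ⟨w, r, fun _ => h⟩
    · exact ⟨0, 0, fun h => absurd h hx⟩
  choose w r hwr using hsel2
  obtain ⟨u, hu, hdisj, hcov⟩ := Vitali.exists_disjoint_subfamily_covering_enlargement_closedBall
    (G ∩ E) w r R (fun x hx => (hwr x hx).2.1) 4 (by norm_num)
  have hcount : u.Countable := hdisj.countable_of_nonempty_interior fun x hx =>
    (nonempty_ball.2 (hwr x (hu hx)).1).mono ball_subset_interior_closedBall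
  calc volume F ≤ volume ((Gᶜ ∩ E) ∪ ⋃ b ∈ u, F ∩ closedBall (w b) (4 * r b)) := by
        apply measure_mono
        intro x hx
        by_cases hxG : x ∈ G
        · right
          obtain ⟨b, hb, hsub⟩ := hcov x ⟨hxG, hFE hx⟩
          exact Set.mem_biUnion hb ⟨hx, hsub (hwr x ⟨hxG, hFE hx⟩).2.2.1⟩
        · exact Or.inl ⟨hxG, hFE hx⟩
    _ ≤ volume (Gᶜ ∩ E) + volume (⋃ b ∈ u, F ∩ closedBall (w b) (4 * r b)) :=
        measure_union_le _ _
    _ = volume (⋃ b ∈ u, F ∩ closedBall (w b) (4 * r b)) := by rw [hnull, zero_add]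
    _ ≤ ∑' b : u, volume (F ∩ closedBall (w b) (4 * r b)) := measure_biUnion_le _ hcount _
    _ ≤ ∑' b : u, 2⁻¹ * volume (E ∩ closedBall (w b) (r b)) := by
        refine ENNReal.tsum_le_tsum fun b => ?_
        obtain ⟨h1, h2, h3, h4, h5, h6⟩ := hwr b (hu b.2)
        exact jn_local f hf hb hM (ball z R) a lam c hc (w b) (r b) h1 h4 h5 h6
    _ = 2⁻¹ * ∑' b : u, (volume.restrict E) (closedBall (w b) (r b)) := by
        rw [ENNReal.tsum_mul_left]
        congr 2
        funext b
        rw [Measure.restrict_apply measurableSet_closedBall, Set.inter_comm]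
    _ = 2⁻¹ * (volume.restrict E) (⋃ b ∈ u, closedBall (w b) (r b)) := by
        rw [measure_biUnion hcount hdisj fun _ _ => measurableSet_closedBall]
    _ ≤ 2⁻¹ * volume E := by
        refine mul_le_mul_right ?_ _
        exact (measure_mono (Set.subset_univ _)).trans (le_of_eq (Measure.restrict_apply_univ E))

theorem john_nirenberg_halving (d : ℕ) (hd : 1 ≤ d) :
    ∃ c : ℝ, 0 < c ∧
      ∀ f : EuclideanSpace ℝ (Fin d) → ℝ,
        LocallyIntegrable f volume → bmoNormRd f ≠ ∞ →
        ∀ (z : EuclideanSpace ℝ (Fin d)) (R : ℝ), 0 < R →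
          ∀ n : ℕ, 1 ≤ n →
            volume {x ∈ ball z R |
                c * (n + 1) * (bmoNormRd f).toReal < |f x - ballMean f (ball z R)|} ≤
              2⁻¹ * volume {x ∈ ball z R |
                c * n * (bmoNormRd f).toReal < |f x - ballMean f (ball z R)|} := by
  refine ⟨3 * 5 ^ d + 5 ^ d * 2 ^ (d + 2), by positivity, ?_⟩
  intro f hf hb z R hR n hn
  rcases (ENNReal.toReal_nonneg (a := bmoNormRd f)).eq_or_lt with h0 | hM
  · have hz : bmoNormRd f = 0 := (ENNReal.toReal_eq_zero_iff _).1 h0.symm |>.resolve_right hb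
    have h1 : (∫⁻ x in ball z R, ENNReal.ofReal |f x - ballMean f (ball z R)|)
        / volume (ball z R) ≤ bmoNormRd f :=
      le_iSup_of_le z (le_iSup_of_le R (le_iSup_of_le hR le_rfl))
    rw [hz, ENNReal.div_le_iff (measure_ball_pos _ _ hR).ne' measure_ball_lt_top.ne,
      zero_mul] at h1
    have hm : AEMeasurable (fun x => ENNReal.ofReal |f x - ballMean f (ball z R)|)
        (volume.restrict (ball z R)) := by
      have := hf.aestronglyMeasurable.aemeasurable.restrict (s := ball z R)
      exact ((this.sub_const _).norm).ennreal_ofReal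
    have h2 := (lintegral_eq_zero_iff' hm).1 (le_antisymm h1 zero_le)
    have h3 := (ae_restrict_iff' measurableSet_ball).1 h2
    refine le_trans (le_of_eq ?_) zero_le
    refine measure_mono_null ?_ (mem_ae_iff.1 h3)
    rintro x ⟨hx, hlt⟩ hcon
    have := hcon hx
    rw [← h0, mul_zero] at hlt
    simp only [Pi.zero_apply, ENNReal.ofReal_eq_zero] at this
    linarith
  · have hn' : (1 : ℝ) ≤ n := by exact_mod_cast hn
    have := jn_pos f hf hb hM z R hR
      ((3 * 5 ^ d + 5 ^ d * 2 ^ (d + 2)) * n * (bmoNormRd f).toReal) _ rfl (by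
        gcongr
        exact le_mul_of_one_le_right (by positivity) hn')
    convert this using 6
    ring
end

section
/- Let (X, 𝓜, μ) be a measure space equipped with a ball-basis 𝔅. If E ⊆ X is bounded (i.e. E ⊆ B₀ for some ball B₀ ∈ 𝔅) and a family of balls 𝒢 ⊆ 𝔅 covers E (i.e. E ⊆ ⋃_{G∈𝒢} G), then there exists a finite or infinite sequence of pairwise disjoint balls G_k ∈ 𝒢 such that E ⊆ ⋃_k G_k*. -/
open MeasureTheory Set
open scoped ENNReal NNReal symmDiff

variable {X : Type*}

theorem vitali_covering
    {X : Type*} [MeasurableSpace X] (μ : Measure X) (𝔅 : Set (Set X))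
    (hull : Set X → Set X) (K : ℝ) (hK : 0 < K)
    (hbasis : IsBallBasis μ 𝔅 hull K)
    (E : Set X) (B₀ : Set X) (hB₀ : B₀ ∈ 𝔅) (hEB₀ : E ⊆ B₀)
    (𝒢 : Set (Set X)) (h𝒢 : 𝒢 ⊆ 𝔅) (hcover : E ⊆ ⋃ G ∈ 𝒢, G) :
    ∃ 𝒟 ⊆ 𝒢, 𝒟.Countable ∧ 𝒟.PairwiseDisjoint id ∧ E ⊆ ⋃ G ∈ 𝒟, hull G := by
  classical
  by_cases hbig : ∃ G ∈ 𝒢, (B₀ ∩ G).Nonempty ∧ μ B₀ ≤ 2 * μ G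
  · obtain ⟨G, hG, hne, hle⟩ := hbig
    refine ⟨{G}, by simpa using hG, countable_singleton G, pairwiseDisjoint_singleton _ _, ?_⟩
    simpa using hEB₀.trans (hbasis.subset_hull G (h𝒢 hG) B₀ hB₀ hle hne)
  push Not at hbig
  let t : Set (Set X) := {G | G ∈ 𝒢 ∧ (B₀ ∩ G).Nonempty}
  have hfin : ∀ G ∈ t, μ G ≠ ∞ := fun G hG => (hbasis.measure_lt_top G (h𝒢 hG.1)).ne
  have hle : ∀ G ∈ t, μ G ≤ μ B₀ := fun G hG => by
    refine le_trans ?_ (hbig G hG.1 hG.2).le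
    rw [two_mul]
    exact le_self_add
  have hsub : ∀ G ∈ t, G ⊆ hull B₀ := fun G hG => by
    refine hbasis.subset_hull B₀ hB₀ G (h𝒢 hG.1) ?_ (by rw [inter_comm]; exact hG.2)
    refine (hle G hG).trans ?_
    rw [two_mul]
    exact le_self_add
  obtain ⟨u, hut, hdis, hu⟩ := Vitali.exists_disjoint_subfamily_covering_enlargement
    (fun G : Set X => G) t (fun G => (μ G).toReal) 2 one_lt_two
    (fun _ _ => ENNReal.toReal_nonneg) (μ B₀).toReal
    (fun G hG => ENNReal.toReal_mono (hbasis.measure_lt_top B₀ hB₀).ne (hle G hG))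
    (fun G hG => nonempty_of_measure_ne_zero (hbasis.measure_pos G (h𝒢 hG.1)).ne')
  refine ⟨u, fun G hG => (hut hG).1, ?_, hdis, ?_⟩
  · haveI : IsFiniteMeasure (μ.restrict (hull B₀)) :=
      ⟨by simpa using hbasis.measure_lt_top _ (hbasis.hull_mem B₀ hB₀)⟩
    have h := Measure.countable_meas_pos_of_disjoint_iUnion (μ := μ.restrict (hull B₀))
      (As := fun G : u => (G : Set X))
      (fun G => hbasis.measurableSet _ (h𝒢 (hut G.2).1))
      (fun a b hab => hdis a.2 b.2 (fun h => hab (Subtype.ext h)))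
    have huniv : {i : u | 0 < μ.restrict (hull B₀) (i : Set X)} = univ := by
      ext G
      simp only [mem_setOf_eq, mem_univ, iff_true]
      rw [Measure.restrict_apply (hbasis.measurableSet _ (h𝒢 (hut G.2).1)),
        inter_eq_left.2 (hsub _ (hut G.2))]
      exact hbasis.measure_pos _ (h𝒢 (hut G.2).1)
    rw [huniv] at h
    exact countable_coe_iff.1 (countable_univ_iff.1 h)
  · intro x hx
    obtain ⟨G, hG, hxG⟩ := mem_iUnion₂.1 (hcover hx)
    have hGt : G ∈ t := ⟨hG, x, hEB₀ hx, hxG⟩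
    obtain ⟨b, hb, hne, hab⟩ := hu G hGt
    refine mem_iUnion₂.2 ⟨b, hb, hbasis.subset_hull b (h𝒢 (hut hb).1) G (h𝒢 hG) ?_ hne hxG⟩
    have hbf := hfin b (hut hb)
    refine (ENNReal.toReal_le_toReal (hfin G hGt) (ENNReal.mul_ne_top (by simp) hbf)).1 ?_
    simpa [ENNReal.toReal_mul] using hab
end
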